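/- Let E be a finite-dimensional real normed vector space, f : ℝ^m → E a smooth function, r ≥ 0, and x_0, …, x_r ∈ ℝ^m. Suppose that for every j = 0, …, r the normalized simplex integral of the j-th derivative vanishes: j!·∫_{T_j} D^j f(σ_j(t)) dt = 0 as a j-multilinear map (i.e. j!·∫_{T_j} D^j f(σ_j(t))(v_1,…,v_j) dt = 0 for all v_1,…,v_j ∈ ℝ^m), where σ_j(t) = x_0 + Σ_{l=1}^{j} t_l(x_l − x_0). If a point y ∈ ℝ^m occurs exactly k times among x_0, …, x_r, then D^i f(y) = 0 for all i = 0, 1, …, k−1. -/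

import Mathlib

open MeasureTheory

/-- The standard `j`-simplex `T_j = {t ∈ ℝ^j | t_l ≥ 0, ∑ t_l ≤ 1}` (of Lebesgue volume `1/j!`). -/
def simplexSet (j : ℕ) : Set (Fin j → ℝ) :=
  {t | (∀ l, 0 ≤ t l) ∧ ∑ l, t l ≤ 1}

/-- The affine parametrization `[x_0, …, x_k] : T_k → ℝ^m`,
`t ↦ x_0 + ∑_{l=1}^k t_l (x_l − x_0)`, of the simplex with vertices `x_0, …, x_k`. -/
def simplexMap {F : Type*} [AddCommGroup F] [Module ℝ F] {k : ℕ} (x : Fin (k + 1) → F)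
    (t : Fin k → ℝ) : F :=
  x 0 + ∑ l : Fin k, t l • (x l.succ - x 0)

section

open Set

lemma isCompact_simplexSet (n : ℕ) : IsCompact (simplexSet n) := by
  refine (isCompact_Icc (a := (0 : Fin n → ℝ)) (b := 1)).of_isClosed_subset ?_ ?_
  · have h : simplexSet n = (⋂ l, {t : Fin n → ℝ | 0 ≤ t l}) ∩ {t | ∑ l, t l ≤ 1} := by
      ext t; simp [simplexSet]
    rw [h]
    exact (isClosed_iInter fun l => isClosed_le continuous_const (continuous_apply l)).inter
      (isClosed_le (by fun_prop) continuous_const)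
  · rintro t ⟨h0, h1⟩
    refine ⟨h0, fun l => le_trans ?_ h1⟩
    exact Finset.single_le_sum (f := t) (fun i _ => h0 i) (Finset.mem_univ l)

lemma volume_real_simplexSet_ne_zero (n : ℕ) : volume.real (simplexSet n) ≠ 0 := by
  have hopen : IsOpen ((⋂ l, {t : Fin n → ℝ | 0 < t l}) ∩ {t | ∑ l, t l < 1}) :=
    (isOpen_iInter_of_finite fun l => isOpen_lt continuous_const (continuous_apply l)).inter
      (isOpen_lt (by fun_prop) continuous_const)
  have hne : ((⋂ l, {t : Fin n → ℝ | 0 < t l}) ∩ {t | ∑ l, t l < 1}).Nonempty := by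
    refine ⟨fun _ => 1 / ((n : ℝ) + 1), ?_, ?_⟩
    · simp only [mem_iInter, mem_ofPred_eq]
      intro _
      positivity
    · have : (0 : ℝ) < n + 1 := by positivity
      simp only [mem_ofPred_eq, Finset.sum_const, Finset.card_univ, Fintype.card_fin, nsmul_eq_mul]
      rw [mul_one_div, div_lt_one this]
      linarith
  have hpos : 0 < volume (simplexSet n) :=
    (hopen.measure_pos volume hne).trans_le <| measure_mono <| by
      rintro t ⟨h0, h1⟩
      simp only [mem_iInter, mem_ofPred_eq] at h0 h1
      exact ⟨fun l => (h0 l).le, h1.le⟩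
  exact (ENNReal.toReal_pos hpos.ne' (isCompact_simplexSet n).measure_lt_top.ne).ne'

section Symmetry

/-- The barycentric coordinates, with respect to the vertices `x_0, …, x_n`, of the point with
affine coordinates `t`. -/
def barycentric (n : ℕ) : (Fin n → ℝ) →ᵃ[ℝ] (Fin (n + 1) → ℝ) where
  toFun t := Fin.cons (1 - ∑ l, t l) t
  linear := LinearMap.pi (Fin.cons (-∑ l, LinearMap.proj l) LinearMap.proj)
  map_vadd' s t := by
    ext i
    refine Fin.cases ?_ (fun _ => ?_) i
    · simp [Finset.sum_add_distrib]
      ring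
    · simp

lemma barycentric_apply {n : ℕ} (t : Fin n → ℝ) :
    barycentric n t = Fin.cons (1 - ∑ l, t l) t := rfl

lemma sum_barycentric {n : ℕ} (t : Fin n → ℝ) : ∑ i, barycentric n t i = 1 := by
  simp [barycentric_apply, Fin.sum_univ_succ]

lemma barycentric_tail {n : ℕ} {w : Fin (n + 1) → ℝ} (hw : ∑ i, w i = 1) :
    barycentric n (Fin.tail w) = w := by
  refine Eq.trans ?_ (Fin.cons_self_tail w)
  rw [Fin.sum_univ_succ] at hw
  simp only [barycentric_apply, Fin.tail]
  congr 1
  linarith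

lemma simplexMap_eq_sum_barycentric {F : Type*} [AddCommGroup F] [Module ℝ F] {n : ℕ}
    (x : Fin (n + 1) → F) (t : Fin n → ℝ) : simplexMap x t = ∑ i, barycentric n t i • x i := by
  simp only [simplexMap, barycentric_apply, Fin.sum_univ_succ, Fin.cons_zero, Fin.cons_succ,
    smul_sub, Finset.sum_sub_distrib, sub_smul, one_smul, Finset.sum_smul]
  abel

lemma mem_simplexSet_iff_barycentric_nonneg {n : ℕ} (t : Fin n → ℝ) :
    t ∈ simplexSet n ↔ ∀ i, 0 ≤ barycentric n t i := by
  simp [simplexSet, barycentric_apply, Fin.forall_fin_succ, and_comm]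

/-- The action on affine coordinates of a permutation of the vertices. -/
def permCoord {n : ℕ} (π : Equiv.Perm (Fin (n + 1))) : (Fin n → ℝ) →ᵃ[ℝ] (Fin n → ℝ) :=
  (LinearMap.funLeft ℝ ℝ (π ∘ Fin.succ)).toAffineMap.comp (barycentric n)

lemma barycentric_permCoord {n : ℕ} (π : Equiv.Perm (Fin (n + 1))) (t : Fin n → ℝ) :
    barycentric n (permCoord π t) = barycentric n t ∘ π :=
  barycentric_tail ((Equiv.sum_comp π (barycentric n t)).trans (sum_barycentric t))

lemma permCoord_mul {n : ℕ} (π ρ : Equiv.Perm (Fin (n + 1))) :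
    permCoord (ρ * π) = (permCoord π).comp (permCoord ρ) := by
  ext t l
  exact (congrFun (barycentric_permCoord ρ t) (π l.succ)).symm

lemma permCoord_one (n : ℕ) : permCoord (1 : Equiv.Perm (Fin (n + 1))) = AffineMap.id ℝ _ := by
  ext t l
  simp [permCoord, barycentric_apply]

lemma abs_det_linear_permCoord {n : ℕ} (π : Equiv.Perm (Fin (n + 1))) :
    |LinearMap.det (permCoord π).linear| = 1 := by
  have hpow : ∀ N : ℕ, LinearMap.det (permCoord (π ^ N)).linear =
      LinearMap.det (permCoord π).linear ^ N := by
    intro N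
    induction N with
    | zero => simp [permCoord_one]
    | succ N ih => rw [pow_succ, permCoord_mul, AffineMap.comp_linear, LinearMap.det_comp, ih,
        pow_succ']
  have h := hpow (orderOf π)
  rw [pow_orderOf_eq_one, permCoord_one, AffineMap.id_linear, LinearMap.det_id] at h
  rw [← pow_eq_one_iff_of_nonneg (abs_nonneg _) (orderOf_pos π).ne', ← abs_pow, ← h, abs_one]

lemma measurePreserving_permCoord {n : ℕ} (π : Equiv.Perm (Fin (n + 1))) :
    MeasurePreserving (permCoord π) := by
  have hdet := abs_det_linear_permCoord π
  have hlin : MeasurePreserving (permCoord π).linear := by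
    refine ⟨(permCoord π).linear.continuous_of_finiteDimensional.measurable, ?_⟩
    rw [Real.map_linearMap_volume_pi_eq_smul_volume_pi (by intro h; simp [h] at hdet), abs_inv,
      hdet]
    simp
  rw [(permCoord π).decomp]
  exact (measurePreserving_add_right volume (permCoord π 0)).comp hlin

lemma measurableEmbedding_permCoord {n : ℕ} (π : Equiv.Perm (Fin (n + 1))) :
    MeasurableEmbedding (permCoord π) := by
  refine (Topology.IsClosedEmbedding.measurableEmbedding ?_)
  refine (Homeomorph.mk ⟨permCoord π, permCoord π⁻¹, fun t => ?_, fun t => ?_⟩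
    (AffineMap.continuous_of_finiteDimensional _)
    (AffineMap.continuous_of_finiteDimensional _)).isClosedEmbedding
  · rw [← AffineMap.comp_apply, ← permCoord_mul, mul_inv_cancel, permCoord_one, AffineMap.id_apply]
  · rw [← AffineMap.comp_apply, ← permCoord_mul, inv_mul_cancel, permCoord_one, AffineMap.id_apply]

/-- Integrals over a simplex do not depend on the order of its vertices. -/
lemma setIntegral_simplexSet_comp_perm {F G : Type*} [AddCommGroup F] [Module ℝ F]
    [NormedAddCommGroup G] [NormedSpace ℝ G] {n : ℕ} (π : Equiv.Perm (Fin (n + 1)))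
    (x : Fin (n + 1) → F) (g : F → G) :
    ∫ t in simplexSet n, g (simplexMap (x ∘ π) t) = ∫ t in simplexSet n, g (simplexMap x t) := by
  have hset : permCoord π ⁻¹' simplexSet n = simplexSet n := by
    ext t
    simp only [mem_preimage, mem_simplexSet_iff_barycentric_nonneg, barycentric_permCoord,
      Function.comp_apply]
    exact π.forall_congr_right (q := fun i => 0 ≤ barycentric n t i)
  have hmap (t) : simplexMap (x ∘ π) (permCoord π t) = simplexMap x t := by
    simp only [simplexMap_eq_sum_barycentric, barycentric_permCoord, Function.comp_apply]
    exact Equiv.sum_comp π fun i => barycentric n t i • x i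
  rw [← (measurePreserving_permCoord π).setIntegral_preimage_emb (measurableEmbedding_permCoord π),
    hset]
  simp only [hmap]

end Symmetry

lemma continuous_simplexMap {F : Type*} [NormedAddCommGroup F] [NormedSpace ℝ F] {n : ℕ}
    (x : Fin (n + 1) → F) : Continuous (simplexMap x) := by
  unfold simplexMap
  fun_prop

/-- The mean value identity: integrating the derivative of `g` in the direction of an edge `[a, b]`
of a simplex gives the difference of the integrals of `g` over the two faces opposite to `a` and
to `b`. -/
lemma setIntegral_simplexSet_fderiv {F G : Type*} [NormedAddCommGroup F] [NormedSpace ℝ F]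
    [NormedAddCommGroup G] [NormedSpace ℝ G] [CompleteSpace G] {g : F → G} (hg : ContDiff ℝ 1 g)
    {n : ℕ} (a b : F) (x : Fin n → F) :
    ∫ t in simplexSet (n + 1), fderiv ℝ g (simplexMap (Fin.cons a (Fin.cons b x)) t) (b - a) =
      (∫ t in simplexSet n, g (simplexMap (Fin.cons b x) t)) -
        ∫ t in simplexSet n, g (simplexMap (Fin.cons a x) t) := by
  have hmap (s : ℝ) (t : Fin n → ℝ) : simplexMap (Fin.cons a (Fin.cons b x)) (Fin.cons s t) =
      s • (b - a) + simplexMap (Fin.cons a x) t := by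
    simp [simplexMap, Fin.sum_univ_succ]
    abel
  have hmap' (t : Fin n → ℝ) : (1 - ∑ l, t l) • (b - a) + simplexMap (Fin.cons a x) t =
      simplexMap (Fin.cons b x) t := by
    simp only [simplexMap, Fin.cons_zero, Fin.cons_succ, smul_sub, sub_smul, one_smul,
      Finset.sum_sub_distrib, Finset.sum_smul]
    abel
  have hint (c : F) : IntegrableOn (fun t => g (simplexMap (Fin.cons c x) t)) (simplexSet n) :=
    (hg.continuous.comp (continuous_simplexMap _)).continuousOn.integrableOn_compact
      (isCompact_simplexSet n)
  have hcont : Continuous fun z => fderiv ℝ g z (b - a) :=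
    (hg.continuous_fderiv one_ne_zero).clm_apply continuous_const
  have hderiv : Integrable ((simplexSet (n + 1)).indicator fun t =>
      fderiv ℝ g (simplexMap (Fin.cons a (Fin.cons b x)) t) (b - a)) :=
    (integrable_indicator_iff (isCompact_simplexSet _).measurableSet).2 <|
      (hcont.comp (continuous_simplexMap _)).continuousOn.integrableOn_compact
        (isCompact_simplexSet _)
  have hpres := (volume_preserving_piFinSuccAbove (fun _ : Fin (n + 1) => ℝ) 0).symm
  rw [← integral_sub (hint b) (hint a), ← integral_indicator (isCompact_simplexSet _).measurableSet,
    ← integral_indicator (isCompact_simplexSet _).measurableSet, ← hpres.integral_comp',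
    Measure.volume_eq_prod]
  refine (integral_prod_symm _ (hpres.integrable_comp_of_integrable hderiv)).trans ?_
  congr 1
  ext t
  have hcons (s : ℝ) : (MeasurableEquiv.piFinSuccAbove (fun _ : Fin (n + 1) => ℝ) 0).symm (s, t) =
      Fin.cons s t := by
    simp [MeasurableEquiv.piFinSuccAbove, Fin.insertNthEquiv]
  simp only [Function.comp_apply, hcons]
  by_cases ht : t ∈ simplexSet n
  · have hle : 0 ≤ 1 - ∑ l, t l := sub_nonneg.2 ht.2
    have hslice : (fun s : ℝ => (simplexSet (n + 1)).indicator (fun t =>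
        fderiv ℝ g (simplexMap (Fin.cons a (Fin.cons b x)) t) (b - a)) (Fin.cons s t)) =
        (Icc 0 (1 - ∑ l, t l)).indicator fun s =>
          fderiv ℝ g (s • (b - a) + simplexMap (Fin.cons a x) t) (b - a) := by
      ext s
      have hiff : (Fin.cons s t : Fin (n + 1) → ℝ) ∈ simplexSet (n + 1) ↔
          s ∈ Icc 0 (1 - ∑ l, t l) := by
        simp [simplexSet, Fin.forall_fin_succ, Fin.sum_univ_succ, ht.1, le_sub_iff_add_le]
      by_cases hs : s ∈ Icc 0 (1 - ∑ l, t l)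
      · rw [indicator_of_mem hs, indicator_of_mem (hiff.2 hs), hmap]
      · rw [indicator_of_notMem hs, indicator_of_notMem (hiff.not.2 hs)]
    rw [hslice, integral_indicator measurableSet_Icc, integral_Icc_eq_integral_Ioc,
      ← intervalIntegral.integral_of_le hle, indicator_of_mem ht,
      intervalIntegral.integral_eq_sub_of_hasDerivAt
        (f := fun s : ℝ => g (s • (b - a) + simplexMap (Fin.cons a x) t))]
    · simp only [hmap', zero_smul, zero_add]
    · intro s _
      have h1 : HasDerivAt (fun s : ℝ => s • (b - a) + simplexMap (Fin.cons a x) t) (b - a) s := by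
        simpa using ((hasDerivAt_id s).smul_const (b - a)).add_const (simplexMap (Fin.cons a x) t)
      exact ((hg.differentiable one_ne_zero _).hasFDerivAt).comp_hasDerivAt s h1
    · exact (hcont.comp (by fun_prop)).intervalIntegrable _ _
  · rw [indicator_of_notMem ht]
    refine integral_eq_zero_of_ae (Filter.Eventually.of_forall fun s => ?_)
    refine indicator_of_notMem (fun hs => ht ⟨fun l => ?_, ?_⟩) _
    · simpa using hs.1 l.succ
    · have h0 := hs.1 0
      have h1 := hs.2
      simp only [Fin.sum_univ_succ, Fin.cons_zero, Fin.cons_succ] at h0 h1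
      linarith

/-- If the simplex integrals of `D^j f` vanish for all initial segments `x_0, …, x_j` of
`x_0, …, x_r`, then they vanish for all subfamilies of `x_0, …, x_r`. -/
lemma simplex_integral_subfamily_eq_zero {F G : Type*} [NormedAddCommGroup F] [NormedSpace ℝ F]
    [NormedAddCommGroup G] [NormedSpace ℝ G] [CompleteSpace G] {f : F → G}
    (hf : ContDiff ℝ (⊤ : ℕ∞) f) {r : ℕ} (x : Fin (r + 1) → F)
    (hvan : ∀ j : Fin (r + 1), ∀ v : Fin (j : ℕ) → F, ∫ t in simplexSet (j : ℕ),
      iteratedFDeriv ℝ (j : ℕ) f (simplexMap (x ∘ Fin.castLE j.isLt) t) v = 0)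
    {q : ℕ} (hq : q ≤ r) {n : ℕ} {e : Fin (n + 1) → Fin (r + 1)} (he : Function.Injective e)
    (hle : ∀ i, (e i : ℕ) ≤ q) (v : Fin n → F) :
    ∫ t in simplexSet n, iteratedFDeriv ℝ n f (simplexMap (x ∘ e) t) v = 0 := by
  induction q using Nat.strong_induction_on generalizing n with
  | _ q ihq =>
  have hcard {k : ℕ} {e : Fin (k + 1) → Fin (r + 1)} (he : Function.Injective e)
      (hle : ∀ i, (e i : ℕ) ≤ q) : k ≤ q := by
    have := Fintype.card_le_of_injective (fun i => (⟨e i, Nat.lt_succ_of_le (hle i)⟩ : Fin (q + 1)))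
      fun i j hij => he (Fin.ext (by simpa using hij))
    simpa using this
  obtain ⟨d, hd⟩ : ∃ d, q = n + d := Nat.exists_eq_add_of_le (hcard he hle)
  induction d generalizing n with
  | zero =>
    obtain rfl : q = n := hd
    have hinj : Function.Injective
        (fun i => (⟨e i, Nat.lt_succ_of_le (hle i)⟩ : Fin (q + 1))) :=
      fun i j hij => he (Fin.ext (by simpa using hij))
    let π : Equiv.Perm (Fin (q + 1)) :=
      Equiv.ofBijective _ (Finite.injective_iff_bijective.1 hinj)
    have hcomp : x ∘ e = (x ∘ Fin.castLE (Nat.succ_le_succ hq)) ∘ π := by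
      ext i
      rfl
    rw [hcomp, setIntegral_simplexSet_comp_perm π _ fun z => iteratedFDeriv ℝ q f z v]
    exact hvan ⟨q, Nat.lt_succ_of_le hq⟩ v
  | succ d ihd =>
    by_cases hmem : ∃ i, (e i : ℕ) = q
    · obtain ⟨i, hi⟩ := hmem
      rw [← setIntegral_simplexSet_comp_perm (Equiv.swap 0 i) _
        fun z => iteratedFDeriv ℝ n f z v]
      set e₁ := e ∘ Equiv.swap 0 i with he₁
      have hinj₁ : Function.Injective e₁ := he.comp (Equiv.injective _)
      have hle₁ : ∀ i, (e₁ i : ℕ) ≤ q := fun i => hle _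
      have hq₁ : (e₁ 0 : ℕ) = q := by simpa [he₁] using hi
      obtain ⟨c, hc, hcq⟩ : ∃ c : Fin (r + 1), c ∉ Set.range e₁ ∧ (c : ℕ) ≤ q := by
        by_contra! hno
        have hsub : Finset.Iic (⟨q, Nat.lt_succ_of_le hq⟩ : Fin (r + 1)) ⊆
            Finset.univ.image e₁ := by
          intro c hc
          have hcq : (c : ℕ) ≤ q := by simpa [Fin.le_def] using hc
          have : c ∈ Set.range e₁ := by
            by_contra h
            exact absurd (hno c h) (not_lt.2 hcq)
          simpa using this
        have h1 := (Finset.card_le_card hsub).trans Finset.card_image_le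
        simp at h1
        omega
      have hcomp : x ∘ e ∘ Equiv.swap 0 i = Fin.cons (x (e₁ 0)) (x ∘ Fin.tail e₁) := by
        rw [← he₁]
        ext j
        refine Fin.cases ?_ (fun _ => ?_) j <;> simp [Fin.tail]
      have hcons : x ∘ (Fin.cons c e₁ : Fin (n + 2) → Fin (r + 1)) =
          Fin.cons (x c) (Fin.cons (x (e₁ 0)) (x ∘ Fin.tail e₁)) := by
        ext j
        refine Fin.cases ?_ (fun j => Fin.cases ?_ (fun _ => ?_) j) j <;> simp [Fin.tail]
      have hcons' : x ∘ (Fin.cons c (Fin.tail e₁) : Fin (n + 1) → Fin (r + 1)) =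
          Fin.cons (x c) (x ∘ Fin.tail e₁) := by
        ext j
        refine Fin.cases ?_ (fun _ => ?_) j <;> simp
      have hinj : Function.Injective (Fin.cons c e₁ : Fin (n + 2) → Fin (r + 1)) :=
        Fin.cons_injective_iff.2 ⟨hc, hinj₁⟩
      have hinj' : Function.Injective (Fin.cons c (Fin.tail e₁) : Fin (n + 1) → Fin (r + 1)) :=
        Fin.cons_injective_iff.2
          ⟨fun ⟨j, hj⟩ => hc ⟨j.succ, hj⟩, hinj₁.comp (Fin.succ_injective n)⟩
      have hlt : ∀ j, ((Fin.cons c (Fin.tail e₁) : Fin (n + 1) → Fin (r + 1)) j : ℕ) ≤ q - 1 := by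
        have hne (a : Fin (r + 1)) (ha : (a : ℕ) ≤ q) (hn : a ≠ e₁ 0) : (a : ℕ) ≤ q - 1 := by
          have : (a : ℕ) ≠ e₁ 0 := fun h => hn (Fin.ext h)
          omega
        intro j
        refine Fin.cases ?_ (fun j => ?_) j
        · exact hne c hcq fun h => hc ⟨0, h.symm⟩
        · exact hne (e₁ j.succ) (hle₁ _) (hinj₁.ne (Fin.succ_ne_zero j))
      have hface := ihq (q - 1) (by omega) (by omega) hinj' hlt v
      have hbig := ihd hinj (fun j => Fin.cases hcq hle₁ j) (Fin.cons (x (e₁ 0) - x c) v)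
        (by omega)
      have hg : ContDiff ℝ 1 (iteratedFDeriv ℝ n f) :=
        hf.iteratedFDeriv_right (by exact_mod_cast le_top)
      have hfderiv (z w : F) : fderiv ℝ (fun z => iteratedFDeriv ℝ n f z v) z w =
          iteratedFDeriv ℝ (n + 1) f z (Fin.cons w v) := by
        rw [iteratedFDeriv_succ_apply_left, fderiv_continuousMultilinear_apply_const_apply
          (hg.differentiable one_ne_zero z)]
        simp
      have hdiff := setIntegral_simplexSet_fderiv
        (g := fun z => iteratedFDeriv ℝ n f z v)
        ((ContinuousMultilinearMap.apply ℝ (fun _ : Fin n => F) G v).contDiff.comp hg)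
        (x c) (x (e₁ 0)) (x ∘ Fin.tail e₁)
      simp only [hfderiv] at hdiff
      rw [hcons] at hbig
      rw [hcons'] at hface
      rw [hbig, hface, sub_zero] at hdiff
      rw [Function.comp_assoc, hcomp]
      exact hdiff.symm
    · push Not at hmem
      have hlt : ∀ j, (e j : ℕ) ≤ q - 1 := fun j => by
        have := hmem j
        have := hle j
        omega
      exact ihq (q - 1) (by omega) (by omega) he hlt v

end

/-- If all the normalized simplex integrals `j!·∫_{T_j} D^j f(σ_j(t)) dt` (`j = 0, …, r`) of a
smooth `f : ℝ^m → E` vanish as multilinear maps, and a point `y` occurs exactly `k` times among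
the vertices `x_0, …, x_r`, then the `(k−1)`-jet of `f` vanishes at `y`. -/
theorem jet_eq_zero_of_simplex_integrals_eq_zero {m : ℕ} {E : Type*} [NormedAddCommGroup E]
    [NormedSpace ℝ E] [FiniteDimensional ℝ E]
    (f : EuclideanSpace ℝ (Fin m) → E) (hf : ContDiff ℝ (⊤ : ℕ∞) f)
    (r : ℕ) (x : Fin (r + 1) → EuclideanSpace ℝ (Fin m))
    (hvan : ∀ j : Fin (r + 1), ∀ v : Fin (j : ℕ) → EuclideanSpace ℝ (Fin m),
      ((j : ℕ).factorial : ℝ) • ∫ t in simplexSet (j : ℕ),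
        iteratedFDeriv ℝ (j : ℕ) f (simplexMap (x ∘ Fin.castLE j.isLt) t) v = 0)
    (y : EuclideanSpace ℝ (Fin m)) (k : ℕ) (hk : {l : Fin (r + 1) | x l = y}.ncard = k) :
    ∀ i < k, iteratedFDeriv ℝ i f y = 0 := by
  have : CompleteSpace E := FiniteDimensional.complete ℝ E
  intro i hi
  have hsub (j : Fin (r + 1)) (v : Fin (j : ℕ) → EuclideanSpace ℝ (Fin m)) :
      ∫ t in simplexSet (j : ℕ),
        iteratedFDeriv ℝ (j : ℕ) f (simplexMap (x ∘ Fin.castLE j.isLt) t) v = 0 :=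
    (smul_eq_zero.1 (hvan j v)).resolve_left (Nat.cast_ne_zero.2 (Nat.factorial_ne_zero _))
  have hcard : Fintype.card (Fin (i + 1)) ≤ Fintype.card {l : Fin (r + 1) | x l = y} := by
    rw [Fintype.card_fin, ← Nat.card_eq_fintype_card, Nat.card_coe_set_eq, hk]
    exact hi
  obtain ⟨e⟩ := Function.Embedding.nonempty_of_card_le hcard
  have hinj : Function.Injective fun j => (e j : Fin (r + 1)) :=
    Subtype.val_injective.comp e.injective
  have hmap (t : Fin i → ℝ) : simplexMap (x ∘ fun j => (e j : Fin (r + 1))) t = y := by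
    have hy (j) : x (e j) = y := (e j).2
    simp [simplexMap, hy]
  ext v
  have h := simplex_integral_subfamily_eq_zero hf x hsub le_rfl hinj
    (fun j => Nat.le_of_lt_succ (e j : Fin (r + 1)).isLt) v
  simp only [hmap, setIntegral_const] at h
  exact (smul_eq_zero.1 h).resolve_left (volume_real_simplexSet_ne_zero i)
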